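/- arXiv:math/0407363 — 5 statements merged into one kernel-verified Lean document; each statement's English description precedes it below -/
import Mathlib

section
/- Let n ≥ 1 be an integer and let x, y be real numbers with x ≠ y. Then Σ_{k=0}^{n} B_k(x) E_{n-k}(y) = Σ_{l=1}^{n} C(n+1, l+1) · (B_l(x−y) E_{n-l}(y) − (E_{l-1}(y−x)/2) E_{n-l}(x)) + (n+1) (E_n(x)/(x−y) + E_n(y)) − (E_{n+1}(x) − E_{n+1}(y)) / (x−y)². -/
open Finset

/-- The `n`-th Bernoulli polynomial evaluated at a real `x`:
`B_n(x) = ∑_{k=0}^n (n choose k) B_k x^(n-k)`, where `B_k` is the `k`-th Bernoulli number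
(with the convention `B_1 = -1/2`, i.e. generating function `z e^{xz}/(e^z - 1)`). -/
noncomputable def bernoulliPoly (n : ℕ) (x : ℝ) : ℝ :=
  ∑ k ∈ Finset.range (n + 1), ((bernoulli k : ℚ) : ℝ) * (n.choose k : ℝ) * x ^ (n - k)

/-- The `n`-th harmonic number `H_n = ∑_{k=1}^n 1/k` as a real number. -/
noncomputable def harm (n : ℕ) : ℝ :=
  ∑ k ∈ Finset.range n, (1 : ℝ) / (k + 1)

/-- The `n`-th Euler polynomial evaluated at a real `x`, defined via the classical identity
`E_n(x) = (2/(n+1)) * (B_{n+1}(x) - 2^{n+1} B_{n+1}(x/2))`, which is equivalent to the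
generating-function definition `2 e^{xz}/(e^z + 1) = ∑ E_n(x) z^n/n!`. -/
noncomputable def eulerPoly (n : ℕ) (x : ℝ) : ℝ :=
  2 / (n + 1) * (bernoulliPoly (n + 1) x - 2 ^ (n + 1) * bernoulliPoly (n + 1) (x / 2))

def IsApp (f : ℕ → ℝ → ℝ) : Prop :=
  ∃ a : ℕ → ℝ, ∀ n x, f n x = ∑ k ∈ Finset.range (n + 1), a k * (n.choose k : ℝ) * x ^ (n - k)

theorem IsApp.trans {f : ℕ → ℝ → ℝ} (hf : IsApp f) (n : ℕ) (x t : ℝ) :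
    f n (x + t) = ∑ k ∈ Finset.range (n + 1), f k x * (n.choose k : ℝ) * t ^ (n - k) := by
  obtain ⟨a, ha⟩ := hf
  rw [ha]
  simp only [ha, Finset.sum_mul]
  rw [Finset.sum_comm' (t' := Finset.range (n + 1)) (s' := fun j => Finset.Ico j (n + 1))
    (by intro i j; simp only [Finset.mem_range, Finset.mem_Ico]; omega)]
  refine Finset.sum_congr rfl fun j hj => ?_
  have hj' : j ≤ n := by simpa [Nat.lt_succ_iff] using hj
  rw [add_pow, Finset.mul_sum, Finset.sum_Ico_eq_sum_range, show n + 1 - j = n - j + 1 by omega]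
  refine Finset.sum_congr rfl fun i hi => ?_
  have hi' : i ≤ n - j := by simpa [Nat.lt_succ_iff] using hi
  have h := Nat.choose_mul (n := n) (k := j + i) (s := j) (by omega) 
  have h2 : (n.choose (j + i) : ℝ) * ((j + i).choose j : ℝ) = (n.choose j : ℝ) * ((n - j).choose i : ℝ) := by
    rw [Nat.add_sub_cancel_left] at h
    exact_mod_cast h
  rw [Nat.add_sub_cancel_left, Nat.sub_sub]
  linear_combination (-(a j * x ^ i * t ^ (n - (j + i)))) * h2

theorem IsApp.trans' {f : ℕ → ℝ → ℝ} (hf : IsApp f) (n N : ℕ) (h : n ≤ N) (x t : ℝ) :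
    f n (x + t) = ∑ k ∈ Finset.range (N + 1), f k x * (n.choose k : ℝ) * t ^ (n - k) := by
  rw [hf.trans]
  apply Finset.sum_subset
  · intro i; simp only [Finset.mem_range]; omega
  · intro i _ hi
    rw [Nat.choose_eq_zero_of_lt (by simp only [Finset.mem_range] at hi; omega)]
    simp

theorem sumchoose (n j : ℕ) :
    ∑ k ∈ Finset.range (n + 1), k.choose j = (n + 1).choose (j + 1) := by
  induction n with
  | zero => cases j with
    | zero => simp
    | succ j => simp [Nat.choose_eq_zero_of_lt]
  | succ n ih => rw [Finset.sum_range_succ, ih, Nat.choose_succ_succ (n + 1) j]; ring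

theorem sumchoose2 (n j : ℕ) :
    ∑ k ∈ Finset.range (n + 1), k * (n - k).choose j = (n + 1).choose (j + 2) := by
  induction n with
  | zero => simp [Nat.choose_eq_zero_of_lt]
  | succ n ih =>
    rw [Finset.sum_range_succ']
    have : ∀ k ∈ Finset.range (n + 1), (k + 1) * (n + 1 - (k + 1)).choose j
        = k * (n - k).choose j + (n - k).choose j := by
      intro k _
      rw [Nat.add_sub_add_right]; ring
    rw [Finset.sum_congr rfl this, Finset.sum_add_distrib, ih]
    have h3 := Finset.sum_range_reflect (fun k => k.choose j) (n + 1)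
    simp only [Nat.add_sub_cancel] at h3
    rw [h3, sumchoose, Nat.choose_succ_succ (n + 1) (j + 1)]
    ring

theorem IsApp.sumA {f : ℕ → ℝ → ℝ} (hf : IsApp f) (n : ℕ) (u y : ℝ) :
    ∑ k ∈ Finset.range (n + 1), f k (u + y) * y ^ (n - k) =
    ∑ j ∈ Finset.range (n + 1), ((n + 1).choose (j + 1) : ℝ) * (f j u * y ^ (n - j)) := by
  have : ∀ k ∈ Finset.range (n + 1), f k (u + y) * y ^ (n - k) =
      ∑ j ∈ Finset.range (n + 1), (k.choose j : ℝ) * (f j u * y ^ (n - j)) := by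
    intro k hk
    have hk' : k ≤ n := by simpa [Nat.lt_succ_iff] using hk
    rw [hf.trans' k n hk', Finset.sum_mul]
    refine Finset.sum_congr rfl fun j _ => ?_
    by_cases hjk : j ≤ k
    · rw [show n - j = (k - j) + (n - k) by omega, pow_add]; ring
    · rw [Nat.choose_eq_zero_of_lt (by omega)]; simp
  rw [Finset.sum_congr rfl this, Finset.sum_comm]
  refine Finset.sum_congr rfl fun j _ => ?_
  rw [← Finset.sum_mul, ← sumchoose]
  push_cast; rfl

theorem IsApp.sumB {f : ℕ → ℝ → ℝ} (hf : IsApp f) (n : ℕ) (u x : ℝ) :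
    ∑ k ∈ Finset.range (n + 1), (k : ℝ) * x ^ (k - 1) * f (n - k) (u + x) =
    ∑ j ∈ Finset.range n, ((n + 1).choose (j + 2) : ℝ) * (f j u * x ^ (n - 1 - j)) := by
  have : ∀ k ∈ Finset.range (n + 1), (k : ℝ) * x ^ (k - 1) * f (n - k) (u + x) =
      ∑ j ∈ Finset.range (n + 1), ((k * (n - k).choose j : ℕ) : ℝ) * (f j u * x ^ (n - 1 - j)) := by
    intro k hk
    have hk' : k ≤ n := by simpa [Nat.lt_succ_iff] using hk
    rw [hf.trans' (n - k) n (by omega), Finset.mul_sum]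
    refine Finset.sum_congr rfl fun j _ => ?_
    push_cast
    rcases Nat.eq_zero_or_pos k with rfl | hk0
    · simp
    by_cases hjk : j ≤ n - k
    · rw [show n - 1 - j = (k - 1) + (n - k - j) by omega, pow_add]; ring
    · rw [Nat.choose_eq_zero_of_lt (by omega)]; simp
  rw [Finset.sum_congr rfl this, Finset.sum_comm]
  have h2 : ∀ j ∈ Finset.range (n + 1),
      ∑ k ∈ Finset.range (n + 1), ((k * (n - k).choose j : ℕ) : ℝ) * (f j u * x ^ (n - 1 - j))
      = ((n + 1).choose (j + 2) : ℝ) * (f j u * x ^ (n - 1 - j)) := by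
    intro j _
    rw [← Finset.sum_mul, ← sumchoose2]
    push_cast; rfl
  rw [Finset.sum_congr rfl h2, Finset.sum_range_succ, Nat.choose_eq_zero_of_lt (by omega)]
  simp

theorem app_B : IsApp bernoulliPoly := ⟨fun k => ((bernoulli k : ℚ) : ℝ), fun _ _ => rfl⟩

theorem B_aeval (n : ℕ) (x : ℝ) :
    bernoulliPoly n x = Polynomial.aeval x (Polynomial.bernoulli n) := by
  rw [Polynomial.bernoulli_def, map_sum, bernoulliPoly, ← Finset.sum_range_reflect]
  refine Finset.sum_congr rfl fun k hk => ?_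
  have hk' : k ≤ n := by simpa [Nat.lt_succ_iff] using hk
  rw [Polynomial.aeval_monomial]
  simp only [Nat.add_sub_cancel]
  rw [Nat.choose_symm hk', Nat.sub_sub_self hk']
  simp

theorem B_succ (n : ℕ) (x : ℝ) :
    bernoulliPoly n (x + 1) = bernoulliPoly n x + n * x ^ (n - 1) := by
  have h := congrArg (Polynomial.aeval x) (Polynomial.bernoulli_comp_one_add_X n)
  rw [Polynomial.aeval_comp] at h
  simp only [map_add, map_one, Polynomial.aeval_X, map_pow, nsmul_eq_mul, map_mul, map_natCast] at h
  rw [B_aeval, B_aeval, add_comm x 1, h]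

noncomputable def gM (n : ℕ) (y : ℝ) : ℝ :=
  2 ^ n * (bernoulliPoly n (y / 2) + bernoulliPoly n (y / 2 + 1 / 2)) - 2 * bernoulliPoly n y

theorem gM_trans (n : ℕ) (x t : ℝ) :
    gM n (x + t) = ∑ k ∈ Finset.range (n + 1), gM k x * (n.choose k : ℝ) * t ^ (n - k) := by
  unfold gM
  rw [show (x + t) / 2 + 1 / 2 = (x / 2 + 1 / 2) + t / 2 by ring, add_div, app_B.trans, app_B.trans,
    app_B.trans, ← Finset.sum_add_distrib, Finset.mul_sum, Finset.mul_sum, ← Finset.sum_sub_distrib]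
  refine Finset.sum_congr rfl fun k hk => ?_
  have hk' : k ≤ n := by simpa [Nat.lt_succ_iff] using hk
  have : (2 : ℝ) ^ n * (t / 2) ^ (n - k) = 2 ^ k * t ^ (n - k) := by
    rw [div_pow]
    nth_rewrite 1 [show n = k + (n - k) by omega]
    rw [pow_add]; field_simp
  linear_combination (n.choose k : ℝ) *
    (bernoulliPoly k (x / 2) + bernoulliPoly k (x / 2 + 1 / 2)) * this

theorem gM_per (n : ℕ) (x : ℝ) : gM n (x + 1) = gM n x := by
  unfold gM
  rw [show (x + 1) / 2 + 1 / 2 = x / 2 + 1 by ring, show (x + 1) / 2 = x / 2 + 1 / 2 by ring,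
    B_succ, B_succ]
  rcases n with _ | n
  · simp; ring
  · simp only [Nat.add_sub_cancel, div_pow]
    field_simp
    ring

theorem gM_zero (n : ℕ) : ∀ x, gM n x = 0 := by
  induction n using Nat.strong_induction_on with
  | _ n ih =>
    intro x
    have h := gM_trans (n + 1) x 1
    rw [gM_per, Finset.sum_range_succ, Finset.sum_range_succ, Finset.sum_eq_zero] at h
    · simp at h
      rcases h with h | h
      · exact h
      · exfalso
        have : (0 : ℝ) ≤ n := Nat.cast_nonneg n
        linarith
    · intro i hi
      rw [ih i (by simpa using hi)]; simp

theorem E_succ (n : ℕ) (y : ℝ) : eulerPoly n (y + 1) = 2 * y ^ n - eulerPoly n y := by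
  have h := gM_zero (n + 1) y
  unfold gM at h
  rw [← add_div] at h
  unfold eulerPoly
  rw [B_succ]
  have hn : (n : ℝ) + 1 ≠ 0 := by positivity
  simp only [Nat.add_sub_cancel]
  push_cast
  field_simp
  linear_combination - h

theorem app_E : IsApp eulerPoly := by
  refine ⟨fun k => 2 / (k + 1) * ((bernoulli (k + 1) : ℚ) : ℝ) * (1 - 2 ^ (k + 1)), fun n x => ?_⟩
  unfold eulerPoly bernoulliPoly
  rw [Finset.mul_sum, ← Finset.sum_sub_distrib, Finset.mul_sum, Finset.sum_range_succ']
  have h0 : (2 : ℝ) ^ (n + 1) * (x / 2) ^ (n + 1) = x ^ (n + 1) := by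
    rw [← mul_pow]; congr 1; ring
  have hz : 2 / ((n : ℝ) + 1) * (((bernoulli 0 : ℚ) : ℝ) * ((n + 1).choose 0 : ℝ) * x ^ (n + 1 - 0) -
      2 ^ (n + 1) * (((bernoulli 0 : ℚ) : ℝ) * ((n + 1).choose 0 : ℝ) * (x / 2) ^ (n + 1 - 0))) = 0 := by
    simp only [Nat.sub_zero]
    linear_combination (-(2 / ((n : ℝ) + 1)) * (((bernoulli 0 : ℚ) : ℝ) * ((n + 1).choose 0 : ℝ))) * h0
  rw [hz, add_zero]
  refine Finset.sum_congr rfl fun k hk => ?_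
  have hk' : k ≤ n := by simpa [Nat.lt_succ_iff] using hk
  have h1 : (2 : ℝ) ^ (n + 1) * (x / 2) ^ (n - k) = 2 ^ (k + 1) * x ^ (n - k) := by
    rw [div_pow]
    nth_rewrite 1 [show n + 1 = (k + 1) + (n - k) by omega]
    rw [pow_add]; field_simp
  have h2 : ((n : ℝ) + 1) * (n.choose k : ℝ) = ((n + 1).choose (k + 1) : ℝ) * (k + 1) := by
    exact_mod_cast Nat.add_one_mul_choose_eq n k
  have hn : (n : ℝ) + 1 ≠ 0 := by positivity
  have hk1 : (k : ℝ) + 1 ≠ 0 := by positivity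
  have h3 : ((n + 1).choose (k + 1) : ℝ) / ((n : ℝ) + 1) = (n.choose k : ℝ) / (k + 1) := by
    field_simp; linear_combination - h2
  rw [Nat.add_sub_add_right]
  set b := ((bernoulli (k + 1) : ℚ) : ℝ)
  calc _ = 2 * (((n + 1).choose (k + 1) : ℝ) / ((n : ℝ) + 1)) * b *
        (x ^ (n - k) - 2 ^ (n + 1) * (x / 2) ^ (n - k)) := by ring
    _ = _ := by rw [h1, h3]; ring

def IsPol (f : ℝ → ℝ) : Prop := ∃ p : Polynomial ℝ, ∀ t, f t = p.eval t

theorem IsPol.add {f g : ℝ → ℝ} (hf : IsPol f) (hg : IsPol g) : IsPol fun t => f t + g t := by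
  obtain ⟨p, hp⟩ := hf
  obtain ⟨q, hq⟩ := hg
  exact ⟨p + q, fun t => by simp [hp, hq]⟩

theorem IsPol.sub {f g : ℝ → ℝ} (hf : IsPol f) (hg : IsPol g) : IsPol fun t => f t - g t := by
  obtain ⟨p, hp⟩ := hf
  obtain ⟨q, hq⟩ := hg
  exact ⟨p - q, fun t => by simp [hp, hq]⟩

theorem IsPol.mul {f g : ℝ → ℝ} (hf : IsPol f) (hg : IsPol g) : IsPol fun t => f t * g t := by
  obtain ⟨p, hp⟩ := hf
  obtain ⟨q, hq⟩ := hg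
  exact ⟨p * q, fun t => by simp [hp, hq]⟩

theorem IsPol.const (c : ℝ) : IsPol fun _ => c := ⟨Polynomial.C c, fun t => by simp⟩

theorem IsPol.div {f : ℝ → ℝ} (hf : IsPol f) (c : ℝ) : IsPol fun t => f t / c := by
  simp only [div_eq_mul_inv]
  exact hf.mul (IsPol.const _)

theorem IsPol.sum {s : Finset ℕ} {f : ℕ → ℝ → ℝ} (hf : ∀ i, IsPol (f i)) :
    IsPol fun t => ∑ i ∈ s, f i t := by
  choose p hp using hf
  exact ⟨∑ i ∈ s, p i, fun t => by simp [hp, Polynomial.eval_finsetSum]⟩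

theorem IsApp.pol {f : ℕ → ℝ → ℝ} (hf : IsApp f) (n : ℕ) (x : ℝ) : IsPol fun t => f n (x + t) := by
  refine ⟨∑ k ∈ Finset.range (n + 1),
    Polynomial.C (f k x * (n.choose k : ℝ)) * Polynomial.X ^ (n - k), fun t => ?_⟩
  show f n (x + t) = _
  rw [hf.trans, Polynomial.eval_finsetSum]
  simp

theorem IsPol.eq_zero {f : ℝ → ℝ} (hf : IsPol f) (h : ∀ t, f (t + 1) + f t = 0) (t : ℝ) :
    f t = 0 := by
  obtain ⟨p, hp⟩ := hf
  have h2 : ∀ t, f (t + 2) = f t := by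
    intro t
    have a := h t
    have b := h (t + 1)
    rw [show t + 1 + 1 = t + 2 by ring] at b
    linarith
  have h3 : ∀ m : ℕ, f (2 * m) = f 0 := by
    intro m
    induction m with
    | zero => simp
    | succ m ih => rw [← ih, ← h2 (2 * m)]; push_cast; ring_nf
  have h4 : p = Polynomial.C (f 0) := by
    apply Polynomial.eq_of_infinite_eval_eq
    apply Set.infinite_of_injective_forall_mem (f := fun m : ℕ => (2 * m : ℝ))
    · intro a b hab
      simpa using hab
    · intro m
      simp only [Set.mem_ofPred_eq, Polynomial.eval_C]
      rw [← hp, h3]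
  have h5 : ∀ t, f t = f 0 := by
    intro t; rw [hp, h4]; simp
  have := h t
  rw [h5 (t + 1), h5 t] at this
  rw [h5]; linarith

noncomputable def Lf (n : ℕ) (x y : ℝ) : ℝ :=
  ∑ k ∈ Finset.range (n + 1), bernoulliPoly k x * eulerPoly (n - k) y

noncomputable def Rf (n : ℕ) (d x y : ℝ) : ℝ :=
    (∑ l ∈ Finset.range n, ((n + 1).choose (l + 2) : ℝ) *
        (bernoulliPoly (l + 1) d * eulerPoly (n - (l + 1)) y -
          eulerPoly l (-d) / 2 * eulerPoly (n - (l + 1)) x)) +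
      ((n : ℝ) + 1) * (eulerPoly n x / d + eulerPoly n y) -
      (eulerPoly (n + 1) x - eulerPoly (n + 1) y) / d ^ 2

theorem Lf_step (n : ℕ) (x y : ℝ) : Lf n (x + 1) (y + 1) + Lf n x y =
    2 * (∑ j ∈ Finset.range (n + 1), ((n + 1).choose (j + 1) : ℝ) *
      (bernoulliPoly j (x - y) * y ^ (n - j))) +
    ∑ j ∈ Finset.range n, ((n + 1).choose (j + 2) : ℝ) *
      ((2 * (-(x - y)) ^ j - eulerPoly j (-(x - y))) * x ^ (n - 1 - j)) := by
  have hA := app_B.sumA n (x - y) y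
  have hB := app_E.sumB n (-(x - y) + 1) x
  simp only [E_succ] at hB
  rw [show -(x - y) + 1 + x = y + 1 by ring] at hB
  rw [sub_add_cancel] at hA
  rw [← hA, ← hB, Finset.mul_sum, Lf, Lf, ← Finset.sum_add_distrib, ← Finset.sum_add_distrib]
  refine Finset.sum_congr rfl fun k _ => ?_
  rw [B_succ, E_succ]
  ring

theorem Rf_step (n : ℕ) (d x y : ℝ) : Rf n d (x + 1) (y + 1) + Rf n d x y =
    (∑ l ∈ Finset.range n, ((n + 1).choose (l + 2) : ℝ) *
        (2 * bernoulliPoly (l + 1) d * y ^ (n - (l + 1)) -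
          eulerPoly l (-d) * x ^ (n - (l + 1)))) +
      ((n : ℝ) + 1) * (2 * x ^ n / d + 2 * y ^ n) -
      2 * (x ^ (n + 1) - y ^ (n + 1)) / d ^ 2 := by
  have : (∑ l ∈ Finset.range n, ((n + 1).choose (l + 2) : ℝ) *
        (2 * bernoulliPoly (l + 1) d * y ^ (n - (l + 1)) -
          eulerPoly l (-d) * x ^ (n - (l + 1)))) =
      (∑ l ∈ Finset.range n, ((n + 1).choose (l + 2) : ℝ) *
        (bernoulliPoly (l + 1) d * eulerPoly (n - (l + 1)) (y + 1) -
          eulerPoly l (-d) / 2 * eulerPoly (n - (l + 1)) (x + 1))) +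
      (∑ l ∈ Finset.range n, ((n + 1).choose (l + 2) : ℝ) *
        (bernoulliPoly (l + 1) d * eulerPoly (n - (l + 1)) y -
          eulerPoly l (-d) / 2 * eulerPoly (n - (l + 1)) x)) := by
    rw [← Finset.sum_add_distrib]
    refine Finset.sum_congr rfl fun k _ => ?_
    rw [E_succ, E_succ]
    ring
  rw [this, Rf, Rf]
  simp only [E_succ n, E_succ (n + 1)]
  ring

theorem binom_id (n : ℕ) (x y : ℝ) (h : x - y ≠ 0) :
    ∑ j ∈ Finset.range n, ((n + 1).choose (j + 2) : ℝ) * ((-(x - y)) ^ j * x ^ (n - 1 - j)) =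
    ((n : ℝ) + 1) * x ^ n / (x - y) - (x ^ (n + 1) - y ^ (n + 1)) / (x - y) ^ 2 := by
  have hb := add_pow (-(x - y)) x (n + 1)
  rw [show -(x - y) + x = y by ring, Finset.sum_range_succ', Finset.sum_range_succ'] at hb
  have : ∑ k ∈ Finset.range n, (-(x - y)) ^ (k + 1 + 1) * x ^ (n + 1 - (k + 1 + 1)) *
      ((n + 1).choose (k + 1 + 1) : ℝ) = (x - y) ^ 2 *
      ∑ j ∈ Finset.range n, ((n + 1).choose (j + 2) : ℝ) * ((-(x - y)) ^ j * x ^ (n - 1 - j)) := by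
    rw [Finset.mul_sum]
    refine Finset.sum_congr rfl fun k _ => ?_
    rw [show n + 1 - (k + 1 + 1) = n - 1 - k by omega]
    ring
  rw [this] at hb
  simp only [zero_add, pow_one, Nat.add_sub_cancel, Nat.choose_one_right, pow_zero, Nat.sub_zero,
    Nat.choose_zero_right] at hb
  push_cast at hb
  generalize (∑ j ∈ Finset.range n, ((n + 1).choose (j + 2) : ℝ) * ((-(x - y)) ^ j * x ^ (n - 1 - j))) = S at *
  field_simp
  linear_combination - hb

theorem step_eq (n : ℕ) (x y : ℝ) (h : x - y ≠ 0) :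
    Lf n (x + 1) (y + 1) + Lf n x y = Rf n (x - y) (x + 1) (y + 1) + Rf n (x - y) x y := by
  rw [Lf_step, Rf_step, Finset.sum_range_succ']
  have hb := binom_id n x y h
  have h1 : ∑ j ∈ Finset.range n, ((n + 1).choose (j + 2) : ℝ) *
      ((2 * (-(x - y)) ^ j - eulerPoly j (-(x - y))) * x ^ (n - 1 - j)) =
      2 * (∑ j ∈ Finset.range n, ((n + 1).choose (j + 2) : ℝ) * ((-(x - y)) ^ j * x ^ (n - 1 - j)))
      - ∑ j ∈ Finset.range n, ((n + 1).choose (j + 2) : ℝ) *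
        (eulerPoly j (-(x - y)) * x ^ (n - 1 - j)) := by
    rw [Finset.mul_sum, ← Finset.sum_sub_distrib]
    refine Finset.sum_congr rfl fun k _ => ?_
    ring
  have h2 : ∑ l ∈ Finset.range n, ((n + 1).choose (l + 2) : ℝ) *
        (2 * bernoulliPoly (l + 1) (x - y) * y ^ (n - (l + 1)) -
          eulerPoly l (-(x - y)) * x ^ (n - (l + 1))) =
      2 * (∑ j ∈ Finset.range n, ((n + 1).choose (j + 1 + 1) : ℝ) *
        (bernoulliPoly (j + 1) (x - y) * y ^ (n - (j + 1))))
      - ∑ j ∈ Finset.range n, ((n + 1).choose (j + 2) : ℝ) *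
        (eulerPoly j (-(x - y)) * x ^ (n - 1 - j)) := by
    rw [Finset.mul_sum, ← Finset.sum_sub_distrib]
    refine Finset.sum_congr rfl fun k _ => ?_
    rw [show n - (k + 1) = n - 1 - k by omega]
    ring
  have h0 : bernoulliPoly 0 (x - y) = 1 := by simp [bernoulliPoly]
  rw [h1, h2, hb, h0]
  simp only [zero_add, Nat.choose_one_right, Nat.sub_zero]
  push_cast
  ring

theorem main_eq (n : ℕ) (x y : ℝ) (h : x - y ≠ 0) : Lf n x y = Rf n (x - y) x y := by
  have hp : IsPol fun t => Lf n (x + t) (y + t) - Rf n (x - y) (x + t) (y + t) := by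
    unfold Lf Rf
    refine IsPol.sub (IsPol.sum fun i => (app_B.pol _ _).mul (app_E.pol _ _)) ?_
    refine IsPol.sub (IsPol.add (IsPol.sum fun i => ?_) ?_) ?_
    · exact (IsPol.const _).mul (((IsPol.const _).mul (app_E.pol _ _)).sub
        ((IsPol.const _).mul (app_E.pol _ _)))
    · exact (IsPol.const _).mul (((app_E.pol _ _).div _).add (app_E.pol _ _))
    · exact ((app_E.pol _ _).sub (app_E.pol _ _)).div _
  have := hp.eq_zero (fun t => by
    have := step_eq n (x + t) (y + t) (by simpa using h)
    rw [add_sub_add_right_eq_sub] at this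
    simp only [← add_assoc]
    linarith) 0
  simp only [add_zero] at this
  linarith

theorem stmt_11 (n : ℕ) (hn : 1 ≤ n) (x y : ℝ) (hxy : x ≠ y) :
    (∑ k ∈ Finset.range (n + 1), bernoulliPoly k x * eulerPoly (n - k) y) =
    (∑ l ∈ Finset.Icc 1 n, ((n + 1).choose (l + 1) : ℝ) *
        (bernoulliPoly l (x - y) * eulerPoly (n - l) y -
          eulerPoly (l - 1) (y - x) / 2 * eulerPoly (n - l) x)) +
      ((n : ℝ) + 1) * (eulerPoly n x / (x - y) + eulerPoly n y) -
      (eulerPoly (n + 1) x - eulerPoly (n + 1) y) / (x - y) ^ 2 := by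
  have h := main_eq n x y (sub_ne_zero.mpr hxy)
  unfold Lf Rf at h
  rw [h, ← Finset.Ico_add_one_right_eq_Icc, Finset.sum_Ico_eq_sum_range, neg_sub]
  simp only [Nat.add_sub_cancel]
  congr 2
  refine Finset.sum_congr rfl fun k _ => ?_
  rw [add_comm 1 k, Nat.add_sub_cancel]
end

section
/- Let n ≥ 0 be an integer. Then for every real number x, (n+2) Σ_{k=0}^{n} E_k(x) E_{n-k}(x) = 8 Σ_{l=2}^{n+2} C(n+2, l) (2^l − 1) (B_l/l) B_{n+2-l}(x). -/
open Finset

lemma appell_zero (f : ℕ → ℝ → ℝ) (c : ℕ → ℝ) (hc : ∀ n, c n ≠ 0) (h0 : ∀ x, f 0 x = 0)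
    (hd : ∀ n x, HasDerivAt (f (n+1)) (c n * f n x) x) (h1 : ∀ n, f n 1 = f n 0) :
    ∀ n x, f n x = 0 := by
  intro n
  induction n with
  | zero => exact h0
  | succ n ih =>
    have hconst : ∀ x, f (n+1) x = f (n+1) 0 := by
      intro x
      apply is_const_of_deriv_eq_zero (fun y => (hd n y).differentiableAt)
      intro y
      rw [(hd n y).deriv, ih, mul_zero]
    have hl : ∀ x, f (n+2) x - (c (n+1) * f (n+1) 0) * x = f (n+2) 0 - (c (n+1) * f (n+1) 0) * 0 := by
      intro x
      have hh : ∀ y, HasDerivAt (fun x => f (n+2) x - (c (n+1) * f (n+1) 0) * x)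
          (c (n+1) * f (n+1) y - (c (n+1) * f (n+1) 0) * 1) y := fun y =>
        (hd (n+1) y).sub ((hasDerivAt_id y).const_mul _)
      apply is_const_of_deriv_eq_zero (f := fun x => f (n+2) x - (c (n+1) * f (n+1) 0) * x)
        (fun y => (hh y).differentiableAt)
      intro y
      rw [(hh y).deriv, hconst y]; ring
    have h := hl 1
    rw [h1 (n+2)] at h
    have h2 : c (n+1) * f (n+1) 0 = 0 := by linarith
    intro x
    rw [hconst x]
    exact (mul_eq_zero.mp h2).resolve_left (hc _)

lemma bp_zero_index (x : ℝ) : bernoulliPoly 0 x = 1 := by simp [bernoulliPoly]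

lemma bp_at_zero (n : ℕ) : bernoulliPoly n 0 = ((bernoulli n : ℚ) : ℝ) := by
  unfold bernoulliPoly
  rw [Finset.sum_range_succ, Finset.sum_eq_zero]
  · simp
  · intro k hk
    have : n - k ≠ 0 := by have := Finset.mem_range.mp hk; omega
    simp [this]

lemma bp_at_one (n : ℕ) : bernoulliPoly n 1 = bernoulliPoly n 0 + if n = 1 then 1 else 0 := by
  rw [bp_at_zero]
  unfold bernoulliPoly
  rw [Finset.sum_range_succ]
  have h := congrArg (fun q : ℚ => (q : ℝ)) (sum_bernoulli n)
  simp only [Rat.cast_sum, Rat.cast_mul, Rat.cast_natCast] at h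
  have h' : ∑ k ∈ Finset.range n, ((bernoulli k : ℚ) : ℝ) * (n.choose k : ℝ) * 1 ^ (n - k)
      = if n = 1 then 1 else 0 := by
    rw [Finset.sum_congr rfl (g := fun k => (n.choose k : ℝ) * ((bernoulli k : ℚ) : ℝ))
      (fun k _ => by rw [one_pow]; ring), h]
    split_ifs <;> simp
  rw [h']; simp; ring

lemma bp_deriv (n : ℕ) (x : ℝ) :
    HasDerivAt (bernoulliPoly (n+1)) (((n:ℝ)+1) * bernoulliPoly n x) x := by
  have h : HasDerivAt (fun x : ℝ => ∑ k ∈ Finset.range (n + 1 + 1),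
      ((bernoulli k : ℚ) : ℝ) * ((n+1).choose k : ℝ) * x ^ (n + 1 - k))
      (∑ k ∈ Finset.range (n + 1 + 1),
      ((bernoulli k : ℚ) : ℝ) * ((n+1).choose k : ℝ) * (((n + 1 - k : ℕ) : ℝ) * x ^ (n + 1 - k - 1))) x :=
    HasDerivAt.fun_sum fun k _ => (hasDerivAt_pow _ _).const_mul _
  refine HasDerivAt.congr_deriv h ?_
  symm
  rw [Finset.sum_range_succ]
  simp only [Nat.sub_self, Nat.cast_zero, zero_mul, mul_zero, add_zero]
  unfold bernoulliPoly
  rw [Finset.mul_sum]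
  apply Finset.sum_congr rfl
  intro k hk
  have hk := Finset.mem_range.mp hk
  have e : n + 1 - k - 1 = n - k := by omega
  have hc : ((n:ℝ)+1) * (n.choose k : ℝ) = ((n+1).choose k : ℝ) * ((n+1-k : ℕ) : ℝ) := by
    have := Nat.add_one_mul_choose_eq n k
    have h3 := Nat.choose_mul_succ_eq n k
    have : ((n.choose k * (n+1) : ℕ) : ℝ) = (((n+1).choose k * (n+1-k) : ℕ) : ℝ) := by rw [h3]
    push_cast at this ⊢
    linarith
  rw [e]
  linear_combination ((bernoulli k : ℚ) : ℝ) * x ^ (n-k) * hc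

lemma bp_dup (n : ℕ) (x : ℝ) :
    2 ^ n * (bernoulliPoly n (x/2) + bernoulliPoly n ((x+1)/2)) - 2 * bernoulliPoly n x = 0 := by
  refine appell_zero (fun n x => 2 ^ n * (bernoulliPoly n (x/2) + bernoulliPoly n ((x+1)/2))
    - 2 * bernoulliPoly n x) (fun n => (n:ℝ)+1) (fun n => by positivity) ?_ ?_ ?_ n x
  · intro x; simp only [bp_zero_index]; norm_num
  · intro n x
    have h1 : HasDerivAt (fun x : ℝ => bernoulliPoly (n+1) (x/2))
      (((n:ℝ)+1) * bernoulliPoly n (x/2) * (1/2)) x :=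
      HasDerivAt.comp (h₂ := bernoulliPoly (n+1)) (h := fun x : ℝ => x/2) x (bp_deriv n (x/2)) ((hasDerivAt_id x).div_const 2)
    have h2 : HasDerivAt (fun x : ℝ => bernoulliPoly (n+1) ((x+1)/2))
      (((n:ℝ)+1) * bernoulliPoly n ((x+1)/2) * (1/2)) x :=
      HasDerivAt.comp (h₂ := bernoulliPoly (n+1)) (h := fun x : ℝ => (x+1)/2) x (bp_deriv n ((x+1)/2)) (((hasDerivAt_id x).add_const 1).div_const 2)
    refine HasDerivAt.congr_deriv (((h1.add h2).const_mul (2^(n+1))).sub ((bp_deriv n x).const_mul 2)) ?_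
    ring
  · intro n
    have e : ((1:ℝ)+1)/2 = 1 := by norm_num
    simp only [e, zero_add, zero_div, bp_at_one n]
    split_ifs with h
    · subst h; ring
    · ring

lemma ep_zero_index (x : ℝ) : eulerPoly 0 x = 1 := by
  simp [eulerPoly, bernoulliPoly, Finset.sum_range_succ]; ring

lemma ep_deriv (n : ℕ) (x : ℝ) :
    HasDerivAt (eulerPoly (n+1)) (((n:ℝ)+1) * eulerPoly n x) x := by
  have h1 : HasDerivAt (fun x : ℝ => bernoulliPoly (n+1+1) (x/2))
      ((((n+1:ℕ):ℝ)+1) * bernoulliPoly (n+1) (x/2) * (1/2)) x :=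
      HasDerivAt.comp (h₂ := bernoulliPoly (n+1+1)) (h := fun x : ℝ => x/2) x (bp_deriv (n+1) (x/2)) ((hasDerivAt_id x).div_const 2)
  refine HasDerivAt.congr_deriv (((bp_deriv (n+1) x).sub (h1.const_mul (2^(n+1+1)))).const_mul (2 / (((n+1:ℕ):ℝ)+1))) ?_
  unfold eulerPoly
  push_cast
  have a : (n:ℝ)+1 ≠ 0 := by positivity
  have b : (n:ℝ)+1+1 ≠ 0 := by positivity
  field_simp
  ring

lemma ep_at_zero (n : ℕ) : eulerPoly n 0 = 2 / (n+1) * (1 - 2^(n+1)) * ((bernoulli (n+1) : ℚ) : ℝ) := by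
  unfold eulerPoly
  rw [zero_div, bp_at_zero]; ring

lemma ep_at_one (n : ℕ) : eulerPoly n 1 = (if n = 0 then 2 else 0) - eulerPoly n 0 := by
  unfold eulerPoly
  have h := bp_dup (n+1) 0
  have h1 := bp_at_one (n+1)
  simp only [zero_div, zero_add] at h ⊢
  have : (2:ℝ)^(n+1) * bernoulliPoly (n+1) (1/2) =
    2 * bernoulliPoly (n+1) 0 - 2^(n+1) * bernoulliPoly (n+1) 0 := by linarith
  rw [this, h1]
  by_cases hn : n = 0
  · subst hn; simp; ring
  · simp [hn]; ring

noncomputable def SS (n : ℕ) (x : ℝ) : ℝ :=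
  ∑ k ∈ Finset.range (n + 1), eulerPoly k x * eulerPoly (n - k) x

noncomputable def RR (n : ℕ) (x : ℝ) : ℝ :=
  ∑ l ∈ Finset.Icc 2 (n + 2), ((n + 2).choose l : ℝ) * ((2 : ℝ) ^ l - 1) *
      (((bernoulli l : ℚ) : ℝ) / (l : ℝ)) * bernoulliPoly (n + 2 - l) x

lemma ep_deriv' (n : ℕ) (x : ℝ) :
    HasDerivAt (eulerPoly n) ((n:ℝ) * eulerPoly (n-1) x) x := by
  cases n with
  | zero =>
    have : eulerPoly 0 = fun _ => 1 := funext ep_zero_index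
    rw [this]; simpa using hasDerivAt_const x (1:ℝ)
  | succ n => simpa using ep_deriv n x

lemma bp_deriv' (n : ℕ) (x : ℝ) :
    HasDerivAt (bernoulliPoly n) ((n:ℝ) * bernoulliPoly (n-1) x) x := by
  cases n with
  | zero =>
    have : bernoulliPoly 0 = fun _ => 1 := funext bp_zero_index
    rw [this]; simpa using hasDerivAt_const x (1:ℝ)
  | succ n => simpa using bp_deriv n x

lemma SS_deriv (n : ℕ) (x : ℝ) : HasDerivAt (SS (n+1)) (((n:ℝ)+2) * SS n x) x := by
  have h : HasDerivAt (SS (n+1)) (∑ k ∈ Finset.range (n+1+1),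
    (((k:ℝ) * eulerPoly (k-1) x) * eulerPoly (n+1-k) x +
      eulerPoly k x * (((n+1-k:ℕ):ℝ) * eulerPoly (n+1-k-1) x))) x :=
    HasDerivAt.fun_sum fun k _ => (ep_deriv' k x).mul (ep_deriv' (n+1-k) x)
  refine HasDerivAt.congr_deriv h ?_
  symm
  rw [Finset.sum_add_distrib, Finset.sum_range_succ', Finset.sum_range_succ (n := n+1)]
  simp only [Nat.sub_self, Nat.cast_zero, zero_mul, mul_zero, add_zero]
  rw [← Finset.sum_add_distrib, SS, Finset.mul_sum]
  apply Finset.sum_congr rfl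
  intro k hk
  have hk := Finset.mem_range.mp hk
  have e1 : n + 1 - (k+1) = n - k := by omega
  have e2 : n + 1 - k - 1 = n - k := by omega
  rw [e1, e2, Nat.cast_sub (by omega), Nat.add_sub_cancel]
  push_cast; ring

lemma RR_deriv (n : ℕ) (x : ℝ) : HasDerivAt (RR (n+1)) (((n:ℝ)+3) * RR n x) x := by
  have h : HasDerivAt (RR (n+1)) (∑ l ∈ Finset.Icc 2 (n + 1 + 2), ((n + 1 + 2).choose l : ℝ) * ((2 : ℝ) ^ l - 1) *
      (((bernoulli l : ℚ) : ℝ) / (l : ℝ)) * (((n+1+2-l:ℕ):ℝ) * bernoulliPoly (n + 1 + 2 - l - 1) x)) x :=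
    HasDerivAt.fun_sum fun k _ => (bp_deriv' _ x).const_mul _
  refine HasDerivAt.congr_deriv h ?_
  symm
  rw [show n + 1 + 2 = n + 2 + 1 by ring, Finset.sum_Icc_succ_top (by omega)]
  simp only [Nat.sub_self, Nat.cast_zero, zero_mul, mul_zero, add_zero]
  rw [RR, Finset.mul_sum]
  apply Finset.sum_congr rfl
  intro k hk
  have hk := Finset.mem_Icc.mp hk
  have e : n + 2 + 1 - k - 1 = n + 2 - k := by omega
  have hc : ((n:ℝ)+3) * ((n+2).choose k : ℝ) = ((n+2+1).choose k : ℝ) * ((n+2+1-k : ℕ) : ℝ) := by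
    have h3 := Nat.choose_mul_succ_eq (n+2) k
    have : (((n+2).choose k * (n+2+1) : ℕ) : ℝ) = (((n+2+1).choose k * (n+2+1-k) : ℕ) : ℝ) := by rw [h3]
    rw [Nat.cast_mul, Nat.cast_mul] at this
    rw [← this]; push_cast; ring
  rw [e]
  linear_combination ((2 : ℝ) ^ k - 1) *
      (((bernoulli k : ℚ) : ℝ) / (k : ℝ)) * bernoulliPoly (n + 2 - k) x * hc

lemma SS_step (n : ℕ) : SS (n+1) 1 = SS (n+1) 0 - 4 * eulerPoly (n+1) 0 := by
  unfold SS
  rw [Finset.sum_range_succ, Finset.sum_range_succ', Finset.sum_range_succ _ (n+1), Finset.sum_range_succ' _ n]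
  have : ∀ k ∈ Finset.range n, eulerPoly (k+1) 1 * eulerPoly (n+1-(k+1)) 1 =
      eulerPoly (k+1) 0 * eulerPoly (n+1-(k+1)) 0 := by
    intro k hk
    have hk := Finset.mem_range.mp hk
    rw [ep_at_one (k+1), ep_at_one (n+1-(k+1)), if_neg (by omega), if_neg (by omega)]
    ring
  rw [Finset.sum_congr rfl this]
  simp only [Nat.sub_self, Nat.sub_zero, ep_zero_index]
  rw [ep_at_one (n+1), if_neg (by omega)]
  ring

lemma RR_step (n : ℕ) : RR (n+1) 1 = RR (n+1) 0 + ((n:ℝ)+3) * (2^(n+2) - 1) *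
    (((bernoulli (n+2) : ℚ) : ℝ) / ((n:ℝ)+2)) := by
  have key : ∀ x, RR (n+1) x = (∑ l ∈ Finset.Icc 2 (n + 1), ((n + 1 + 1 + 1).choose l : ℝ) * ((2 : ℝ) ^ l - 1) *
      (((bernoulli l : ℚ) : ℝ) / (l : ℝ)) * bernoulliPoly (n + 1 + 1 + 1 - l) x)
      + ((n + 1 + 1 + 1).choose (n+1+1) : ℝ) * ((2 : ℝ) ^ (n+1+1) - 1) *
      (((bernoulli (n+1+1) : ℚ) : ℝ) / ((n+1+1 : ℕ) : ℝ)) * bernoulliPoly (n + 1 + 1 + 1 - (n+1+1)) x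
      + ((n + 1 + 1 + 1).choose (n+1+1+1) : ℝ) * ((2 : ℝ) ^ (n+1+1+1) - 1) *
      (((bernoulli (n+1+1+1) : ℚ) : ℝ) / ((n+1+1+1 : ℕ) : ℝ)) * bernoulliPoly (n + 1 + 1 + 1 - (n+1+1+1)) x := by
    intro x
    unfold RR
    rw [show n + 1 + 2 = n + 1 + 1 + 1 by ring, Finset.sum_Icc_succ_top (by omega),
      Finset.sum_Icc_succ_top (by omega)]
  rw [key, key]
  have : ∀ l ∈ Finset.Icc 2 (n+1), bernoulliPoly (n+1+1+1-l) 1 = bernoulliPoly (n+1+1+1-l) 0 := by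
    intro l hl
    have hl := Finset.mem_Icc.mp hl
    rw [bp_at_one, if_neg (by omega), add_zero]
  rw [Finset.sum_congr rfl (fun l hl => by rw [this l hl])]
  have e : n + 1 + 1 + 1 - (n+1+1) = 1 := by omega
  rw [e, Nat.sub_self, bp_zero_index, bp_zero_index, bp_at_one 1, if_pos rfl,
    Nat.choose_succ_self_right]
  push_cast
  ring

theorem stmt_12 (n : ℕ) (x : ℝ) :
    ((n : ℝ) + 2) * (∑ k ∈ Finset.range (n + 1), eulerPoly k x * eulerPoly (n - k) x) =
    8 * ∑ l ∈ Finset.Icc 2 (n + 2), ((n + 2).choose l : ℝ) * ((2 : ℝ) ^ l - 1) *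
      (((bernoulli l : ℚ) : ℝ) / (l : ℝ)) * bernoulliPoly (n + 2 - l) x := by
  change ((n:ℝ)+2) * SS n x = 8 * RR n x
  have h0 : ∀ x, (((0:ℕ):ℝ)+2) * SS 0 x - 8 * RR 0 x = 0 := by
    intro x
    simp [SS, RR, ep_zero_index, bp_zero_index, bernoulli_two]
    norm_num
  have := appell_zero (fun n x => ((n:ℝ)+2) * SS n x - 8 * RR n x) (fun n => (n:ℝ)+3)
    (fun n => by positivity) h0 ?_ ?_ n x
  · linarith
  · intro n x
    refine HasDerivAt.congr_deriv (((SS_deriv n x).const_mul (((n+1:ℕ):ℝ)+2)).sub ((RR_deriv n x).const_mul 8)) ?_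
    push_cast; ring
  · intro n
    cases n with
    | zero => simp only [h0]
    | succ n =>
      simp only [SS_step, RR_step, ep_at_zero]
      push_cast
      have b : (n:ℝ)+1+1 ≠ 0 := by positivity
      have b' : (n:ℝ)+2 ≠ 0 := by positivity
      rw [show (n:ℝ)+1+1 = n+2 by ring, show n+1+1 = n+2 by ring]
      field_simp
      ring
end

section
/- Let n ≥ 1 be an integer. Then for all real numbers x and y, Σ_{k=1}^{n} (B_k(x+y)/k) x^{n-k} = Σ_{l=1}^{n} C(n, l) (B_l(y)/l) x^{n-l} + H_n x^n. -/
open Finset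

theorem bernoulliPoly_add (k : ℕ) (x y : ℝ) :
    bernoulliPoly k (x + y) =
      ∑ l ∈ Finset.range (k + 1), (k.choose l : ℝ) * bernoulliPoly l y * x ^ (k - l) := by
  unfold bernoulliPoly
  simp_rw [Finset.mul_sum, Finset.sum_mul, Finset.range_eq_Ico]
  rw [← Finset.sum_Ico_Ico_comm]
  refine Finset.sum_congr rfl fun j hj => ?_
  have hj' : j ≤ k := by simp at hj; omega
  rw [Finset.sum_Ico_eq_sum_range, add_comm x y, add_pow, Finset.mul_sum,
    show k + 1 - j = k - j + 1 by omega]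
  refine Finset.sum_congr rfl fun m hm => ?_
  have hm' : m ≤ k - j := by simp at hm; omega
  have h := Nat.choose_mul (n := k) (k := j + m) (s := j) (by omega)
  rw [show j + m - j = m by omega] at h ⊢
  have h' : (k.choose (j + m) : ℝ) * ((j + m).choose j : ℝ)
      = (k.choose j : ℝ) * ((k - j).choose m : ℝ) := by exact_mod_cast h
  rw [show k - (j + m) = k - j - m by omega]
  linear_combination (-((bernoulli j : ℚ) : ℝ) * y ^ m * x ^ (k - j - m)) * h'

theorem stmt_17 (n : ℕ) (hn : 1 ≤ n) (x y : ℝ) :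
    (∑ k ∈ Finset.Icc 1 n, bernoulliPoly k (x + y) / (k : ℝ) * x ^ (n - k)) =
    (∑ l ∈ Finset.Icc 1 n, (n.choose l : ℝ) * (bernoulliPoly l y / (l : ℝ)) * x ^ (n - l)) +
      harm n * x ^ n := by
  clear hn
  induction n with
  | zero => simp [harm]
  | succ n ih =>
    rw [Finset.sum_Icc_succ_top (by omega)]
    have e1 : ∑ k ∈ Finset.Icc 1 n, bernoulliPoly k (x + y) / (k : ℝ) * x ^ (n + 1 - k)
        = x * ∑ k ∈ Finset.Icc 1 n, bernoulliPoly k (x + y) / (k : ℝ) * x ^ (n - k) := by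
      rw [Finset.mul_sum]
      refine Finset.sum_congr rfl fun k hk => ?_
      rw [Nat.succ_sub (Finset.mem_Icc.1 hk).2, pow_succ]
      ring
    have e2 : x * ∑ l ∈ Finset.Icc 1 n, (n.choose l : ℝ) * (bernoulliPoly l y / (l : ℝ)) *
          x ^ (n - l)
        = ∑ l ∈ Finset.Icc 1 (n + 1), (n.choose l : ℝ) * (bernoulliPoly l y / (l : ℝ)) *
          x ^ (n + 1 - l) := by
      rw [Finset.sum_Icc_succ_top (by omega), Nat.choose_succ_self, Finset.mul_sum]
      simp only [Nat.cast_zero, zero_mul, add_zero]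
      refine Finset.sum_congr rfl fun k hk => ?_
      rw [Nat.succ_sub (Finset.mem_Icc.1 hk).2, pow_succ]
      ring
    have hn0 : ((n : ℝ) + 1) ≠ 0 := by positivity
    have e3 : bernoulliPoly (n + 1) (x + y) / ((n : ℝ) + 1)
        = ∑ l ∈ Finset.Icc 1 (n + 1), (n.choose (l - 1) : ℝ) * (bernoulliPoly l y / (l : ℝ)) *
          x ^ (n + 1 - l) + 1 / ((n : ℝ) + 1) * x ^ (n + 1) := by
      have h0 : bernoulliPoly 0 y = 1 := by simp [bernoulliPoly]
      rw [bernoulliPoly_add, Finset.sum_range_succ', h0, ← Finset.Ico_add_one_right_eq_Icc,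
        Finset.sum_Ico_eq_sum_range, add_div, Finset.sum_div]
      congr 1
      · refine Finset.sum_congr (by simp) fun l hl => ?_
        have h : ((n : ℝ) + 1) * (n.choose l : ℝ) = ((n + 1).choose (l + 1) : ℝ) * ((l : ℝ) + 1) := by
          exact_mod_cast Nat.add_one_mul_choose_eq n l
        have hl0 : ((l : ℝ) + 1) ≠ 0 := by positivity
        rw [add_comm 1 l, Nat.add_sub_cancel]
        push_cast
        field_simp
        linear_combination (-bernoulliPoly (l + 1) y * x ^ (n - l)) * h
      · simp
        ring
    have e4 : harm (n + 1) = harm n + 1 / ((n : ℝ) + 1) := by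
      simp [harm, Finset.sum_range_succ]
    have e5 : ∑ l ∈ Finset.Icc 1 (n + 1), ((n + 1).choose l : ℝ) * (bernoulliPoly l y / (l : ℝ)) *
          x ^ (n + 1 - l)
        = ∑ l ∈ Finset.Icc 1 (n + 1), (n.choose (l - 1) : ℝ) * (bernoulliPoly l y / (l : ℝ)) *
          x ^ (n + 1 - l) + ∑ l ∈ Finset.Icc 1 (n + 1), (n.choose l : ℝ) *
          (bernoulliPoly l y / (l : ℝ)) * x ^ (n + 1 - l) := by
      rw [← Finset.sum_add_distrib]
      refine Finset.sum_congr rfl fun l hl => ?_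
      obtain ⟨m, rfl⟩ : ∃ m, l = m + 1 := ⟨l - 1, by simp at hl; omega⟩
      rw [Nat.choose_succ_succ, Nat.add_sub_cancel]
      push_cast
      ring
    rw [e1, ih, mul_add, e2, e5, e4, Nat.sub_self, pow_zero, mul_one]
    push_cast
    rw [e3]
    ring
end

section
/- Let n ≥ 1 be an integer. Then for all real numbers x and y, Σ_{k=0}^{n} E_k(x+y) x^{n-k} = Σ_{l=0}^{n} C(n+1, l+1) E_l(y) x^{n-l}. -/
open Finset

theorem appell_aux (a : ℕ → ℝ) (n : ℕ) (x y : ℝ) :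
    ∑ k ∈ Finset.range (n + 1), a k * (n.choose k : ℝ) * (x + y) ^ (n - k) =
    ∑ j ∈ Finset.range (n + 1), (n.choose j : ℝ) *
      (∑ k ∈ Finset.range (j + 1), a k * (j.choose k : ℝ) * y ^ (j - k)) * x ^ (n - j) := by
  have h1 : ∀ k ∈ Finset.range (n + 1), a k * (n.choose k : ℝ) * (x + y) ^ (n - k) =
      ∑ j ∈ Finset.Ico k (n + 1), (n.choose j : ℝ) *
        (a k * (j.choose k : ℝ) * y ^ (j - k)) * x ^ (n - j) := by
    intro k hk
    have hk' : k ≤ n := by simpa [Nat.lt_succ_iff] using hk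
    rw [Finset.sum_Ico_eq_sum_range, add_comm x y, add_pow, Finset.mul_sum]
    rw [show n + 1 - k = n - k + 1 by omega]
    refine Finset.sum_congr rfl fun m hm => ?_
    have hm' : m ≤ n - k := by simpa [Nat.lt_succ_iff] using hm
    have hc := Nat.choose_mul (n := n) (k := k + m) (s := k) (by omega)
    rw [Nat.add_sub_cancel_left] at hc
    have hc' : (n.choose (k + m) : ℝ) * ((k + m).choose k : ℝ) =
      (n.choose k : ℝ) * ((n - k).choose m : ℝ) := by exact_mod_cast hc
    rw [Nat.add_sub_cancel_left, show n - (k + m) = n - k - m by omega]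
    linear_combination (-(a k * y ^ m * x ^ (n - k - m))) * hc'
  rw [Finset.sum_congr rfl h1]
  simp_rw [Finset.mul_sum, Finset.sum_mul]
  apply Finset.sum_comm'
  intro k j
  simp only [Finset.mem_range, Finset.mem_Ico]
  omega

theorem bernoulliPoly_add_aux (n : ℕ) (x y : ℝ) : bernoulliPoly n (x + y) =
    ∑ j ∈ Finset.range (n + 1), (n.choose j : ℝ) * bernoulliPoly j y * x ^ (n - j) :=
  appell_aux (fun k => ((bernoulli k : ℚ) : ℝ)) n x y

theorem eulerPoly_add_aux (n : ℕ) (x y : ℝ) : eulerPoly n (x + y) =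
    ∑ j ∈ Finset.range (n + 1), (n.choose j : ℝ) * eulerPoly j y * x ^ (n - j) := by
  unfold eulerPoly
  rw [add_div, bernoulliPoly_add_aux, bernoulliPoly_add_aux, Finset.mul_sum,
    ← Finset.sum_sub_distrib, Finset.sum_range_succ', mul_add,
    Finset.mul_sum]
  have h0 : ∀ z, bernoulliPoly 0 z = 1 := by intro z; simp [bernoulliPoly]
  have hz : (((n + 1).choose 0 : ℕ) : ℝ) * bernoulliPoly 0 y * x ^ (n + 1 - 0) -
      2 ^ (n + 1) * (((n + 1).choose 0 : ℝ) * bernoulliPoly 0 (y / 2) * (x / 2) ^ (n + 1 - 0))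
      = 0 := by
    simp [h0, div_pow]
    field_simp
    ring
  rw [hz, mul_zero, add_zero]
  refine Finset.sum_congr rfl fun j hj => ?_
  have hj' : j ≤ n := by simpa [Nat.lt_succ_iff] using hj
  obtain ⟨m, rfl⟩ := Nat.exists_eq_add_of_le hj'
  have hc : ((j + m : ℕ) + 1 : ℝ) * ((j + m).choose j : ℝ) =
      ((j + m + 1).choose (j + 1) : ℝ) * (j + 1 : ℝ) := by
    exact_mod_cast Nat.add_one_mul_choose_eq (j + m) j
  have hc' : 2 / (((j + m : ℕ) : ℝ) + 1) * ((j + m + 1).choose (j + 1) : ℝ) =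
      ((j + m).choose j : ℝ) * (2 / ((j : ℝ) + 1)) := by
    have h1 : ((j + m : ℕ) : ℝ) + 1 ≠ 0 := by positivity
    have h2 : (j : ℝ) + 1 ≠ 0 := by positivity
    rw [div_mul_eq_mul_div, div_eq_iff h1, mul_div_assoc', div_mul_eq_mul_div, eq_div_iff h2]
    linear_combination (-2) * hc
  rw [show j + m + 1 - (j + 1) = m by omega, show j + m - j = m by omega]
  have hp : (2 : ℝ) ^ (j + m + 1) * (x / 2) ^ m = 2 ^ (j + 1) * x ^ m := by
    rw [div_pow, show j + m + 1 = j + 1 + m by omega, pow_add 2 (j + 1) m]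
    field_simp
  linear_combination (bernoulliPoly (j + 1) y * x ^ m
    - 2 ^ (j + 1) * x ^ m * bernoulliPoly (j + 1) (y / 2)) * hc'
    - 2 / (((j + m : ℕ) : ℝ) + 1) * ((j + m + 1).choose (j + 1) : ℝ)
      * bernoulliPoly (j + 1) (y / 2) * hp

theorem stmt_18 (n : ℕ) (hn : 1 ≤ n) (x y : ℝ) :
    (∑ k ∈ Finset.range (n + 1), eulerPoly k (x + y) * x ^ (n - k)) =
    ∑ l ∈ Finset.range (n + 1), ((n + 1).choose (l + 1) : ℝ) * eulerPoly l y * x ^ (n - l) := by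
  have h1 : ∀ k ∈ Finset.range (n + 1), eulerPoly k (x + y) * x ^ (n - k) =
      ∑ l ∈ Finset.range (k + 1), (k.choose l : ℝ) * (eulerPoly l y * x ^ (n - l)) := by
    intro k hk
    have hk' : k ≤ n := by simpa [Nat.lt_succ_iff] using hk
    rw [eulerPoly_add_aux, Finset.sum_mul]
    refine Finset.sum_congr rfl fun l hl => ?_
    have hl' : l ≤ k := by simpa [Nat.lt_succ_iff] using hl
    rw [show n - l = (k - l) + (n - k) by omega, pow_add]
    ring
  rw [Finset.sum_congr rfl h1,
    Finset.sum_comm' (t' := Finset.range (n + 1)) (s' := fun l => Finset.Icc l n)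
      (by intro k l; simp only [Finset.mem_range, Finset.mem_Icc]; omega)]
  refine Finset.sum_congr rfl fun l _ => ?_
  rw [← Finset.sum_mul, ← Nat.sum_Icc_choose]
  push_cast
  ring
end

section
/- Let n and l be integers with n ≥ l > 0, and let p, q be real numbers with p ≥ 0 and q > 0. Then Σ_{k=l}^{n} C(n−l, k−l) β(k+p, n−k+q) = β(l+p, q), where β(a,b) = Γ(a)Γ(b)/Γ(a+b). -/
open Finset

/-- The Beta function `β(a, b) = Γ(a) Γ(b) / Γ(a + b)` on the reals. -/
noncomputable def betaFn (a b : ℝ) : ℝ :=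
  Real.Gamma a * Real.Gamma b / Real.Gamma (a + b)

theorem betaFn_rec {a b : ℝ} (ha : 0 < a) (hb : 0 < b) :
    betaFn a (b + 1) + betaFn (a + 1) b = betaFn a b := by
  unfold betaFn
  have h1 : a + (b + 1) = (a + b) + 1 := by ring
  have h2 : a + 1 + b = (a + b) + 1 := by ring
  have hab : 0 < a + b := by positivity
  have hG := (Real.Gamma_pos_of_pos hab).ne'
  rw [h1, h2, Real.Gamma_add_one ha.ne', Real.Gamma_add_one hb.ne', Real.Gamma_add_one hab.ne']
  field_simp
  ring

theorem betaFn_sum (m : ℕ) (a b : ℝ) (ha : 0 < a) (hb : 0 < b) :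
    (∑ ij ∈ Finset.HasAntidiagonal.antidiagonal m, (m.choose ij.1 : ℝ) * betaFn (a + ij.1) (b + ij.2)) =
      betaFn a b := by
  induction m with
  | zero => simp
  | succ m ih =>
    rw [Finset.sum_antidiagonal_choose_succ_mul (fun i j => betaFn (a + i) (b + j)), ← ih,
      ← Finset.sum_add_distrib]
    refine Finset.sum_congr rfl fun ij hij => ?_
    have hc : m.choose ij.2 = m.choose ij.1 :=
      (Nat.choose_symm_of_eq_add (Finset.HasAntidiagonal.mem_antidiagonal.mp hij).symm).symm
    rw [hc, ← mul_add, ← betaFn_rec (a := a + ij.1) (b := b + ij.2) (by positivity) (by positivity)]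
    push_cast
    simp only [add_assoc]

theorem stmt_19 (n l : ℕ) (hl : 0 < l) (hln : l ≤ n) (p q : ℝ) (hp : 0 ≤ p) (hq : 0 < q) :
    (∑ k ∈ Finset.Icc l n,
        ((n - l).choose (k - l) : ℝ) * betaFn ((k : ℝ) + p) ((n : ℝ) - (k : ℝ) + q)) =
    betaFn ((l : ℝ) + p) q := by
  obtain ⟨m, rfl⟩ := Nat.exists_eq_add_of_le hln
  have hl' : (0 : ℝ) < l := by exact_mod_cast hl
  rw [← betaFn_sum m ((l : ℝ) + p) q (by positivity) hq,
    Finset.Nat.sum_antidiagonal_eq_sum_range_succ_mk, ← Finset.Ico_add_one_right_eq_Icc,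
    Finset.sum_Ico_eq_sum_range]
  have hm : l + m + 1 - l = m + 1 := by omega
  rw [hm]
  refine Finset.sum_congr rfl fun j hj => ?_
  have hj' : j ≤ m := by simpa [Nat.lt_succ_iff] using hj
  rw [Nat.add_sub_cancel_left, Nat.add_sub_cancel_left]
  push_cast [Nat.cast_sub hj']
  congr 2 <;> ring
end
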